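/- arXiv:1412.8012 — 2 statements merged into one kernel-verified Lean document; each statement's English description precedes it below -/
import Mathlib

section
/- Let 0 < L < 1/4 and 0 < b ≤ 1/4. Let γ₁, γ₂ : [−L, L] → ℝ be twice continuously differentiable functions whose graphs are disjoint (i.e. γ₁(x) ≠ γ₂(x) for every x ∈ [−L, L]) and which satisfy |γᵢ''(x)| ≤ √b for every x ∈ [−L, L] and i = 1, 2. If |γ₁(0) − γ₂(0)| ≤ L², then |γ₁'(0) − γ₂'(0)| ≤ √L. -/
open Real Set

/-- A first-order Taylor estimate on `[-L, L]` with a bounded second derivative. -/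
theorem abs_sub_sub_mul_le_of_abs_deriv2_le {f f' f'' : ℝ → ℝ} {L M : ℝ} (hL : 0 ≤ L)
    (hf : ∀ x ∈ Icc (-L) L, HasDerivAt f (f' x) x)
    (hf' : ∀ x ∈ Icc (-L) L, HasDerivAt f' (f'' x) x)
    (hM : ∀ x ∈ Icc (-L) L, |f'' x| ≤ M) {x : ℝ} (hx : x ∈ Icc (-L) L) :
    |f x - f 0 - f' 0 * x| ≤ M * L ^ 2 := by
  have h0 : (0 : ℝ) ∈ Icc (-L) L := ⟨by linarith, hL⟩
  have hM0 : 0 ≤ M := (abs_nonneg _).trans (hM 0 h0)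
  have hbound : ∀ y ∈ Icc (-L) L, ‖f' y - f' 0‖ ≤ M * L := fun y hy ↦ by
    have h := (convex_Icc (-L) L).norm_image_sub_le_of_norm_hasDerivWithin_le
      (fun z hz ↦ (hf' z hz).hasDerivWithinAt) hM h0 hy
    rw [sub_zero] at h
    exact h.trans (mul_le_mul_of_nonneg_left (abs_le.2 hy) hM0)
  have h := (convex_Icc (-L) L).norm_image_sub_le_of_norm_hasDerivWithin_le
    (f := fun y ↦ f y - f' 0 * y) (f' := fun y ↦ f' y - f' 0)
    (fun z hz ↦ by
      simpa using ((hf z hz).fun_sub ((hasDerivAt_id z).const_mul (f' 0))).hasDerivWithinAt)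
    hbound h0 hx
  simp only [mul_zero, sub_zero, Real.norm_eq_abs] at h
  calc |f x - f 0 - f' 0 * x| = |f x - f' 0 * x - f 0| := by ring_nf
    _ ≤ M * L * |x| := h
    _ ≤ M * L * L := mul_le_mul_of_nonneg_left (abs_le.2 hx) (mul_nonneg hM0 hL)
    _ = M * L ^ 2 := by ring

/-- A function without zeros on `[-L, L]` whose second derivative is bounded by `M` has a
derivative at `0` controlled by its value there. -/
theorem abs_deriv_mul_le_of_ne_zero {f f' f'' : ℝ → ℝ} {L M : ℝ} (hL : 0 ≤ L)
    (hf : ∀ x ∈ Icc (-L) L, HasDerivAt f (f' x) x)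
    (hf' : ∀ x ∈ Icc (-L) L, HasDerivAt f' (f'' x) x)
    (hM : ∀ x ∈ Icc (-L) L, |f'' x| ≤ M) (hne : ∀ x ∈ Icc (-L) L, f x ≠ 0) :
    |f' 0| * L ≤ |f 0| + M * L ^ 2 := by
  have hle : -L ≤ L := by linarith
  by_contra! hlt
  have hr := abs_le.1 (abs_sub_sub_mul_le_of_abs_deriv2_le hL hf hf' hM (right_mem_Icc.2 hle))
  have hl := abs_le.1 (abs_sub_sub_mul_le_of_abs_deriv2_le hL hf hf' hM (left_mem_Icc.2 hle))
  have hcont : ContinuousOn f (uIcc (-L) L) := fun x hx ↦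
    (hf x (uIcc_of_le hle ▸ hx)).continuousAt.continuousWithinAt
  have hmem : (0 : ℝ) ∈ uIcc (f (-L)) (f L) := by
    have h₁ := le_abs_self (f 0)
    have h₂ := neg_abs_le (f 0)
    rw [mem_uIcc]
    rcases abs_cases (f' 0) with ⟨h, -⟩ | ⟨h, -⟩ <;> rw [h] at hlt
    · left; constructor <;> linarith
    · right; constructor <;> linarith
  obtain ⟨x, hx, hx0⟩ := intermediate_value_uIcc hcont hmem
  exact hne x (uIcc_of_le hle ▸ hx) hx0

/-- Sublemma (angleint): two disjoint C²(b)-graphs on [-L, L] with second derivative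
bounded by √b that are L²-close at 0 have derivatives at 0 that are √L-close. -/
theorem sublemma_angleint (L b : ℝ) (hL : 0 < L) (hL' : L < 1/4)
    (hb : 0 < b) (hb' : b ≤ 1/4)
    (γ₁ γ₂ γ₁' γ₂' γ₁'' γ₂'' : ℝ → ℝ)
    (hd1 : ∀ x ∈ Icc (-L) L, HasDerivAt γ₁ (γ₁' x) x)
    (hd1' : ∀ x ∈ Icc (-L) L, HasDerivAt γ₁' (γ₁'' x) x)
    (hc1 : ContinuousOn γ₁'' (Icc (-L) L))
    (hd2 : ∀ x ∈ Icc (-L) L, HasDerivAt γ₂ (γ₂' x) x)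
    (hd2' : ∀ x ∈ Icc (-L) L, HasDerivAt γ₂' (γ₂'' x) x)
    (hc2 : ContinuousOn γ₂'' (Icc (-L) L))
    (hdisj : ∀ x ∈ Icc (-L) L, γ₁ x ≠ γ₂ x)
    (hbd1 : ∀ x ∈ Icc (-L) L, |γ₁'' x| ≤ Real.sqrt b)
    (hbd2 : ∀ x ∈ Icc (-L) L, |γ₂'' x| ≤ Real.sqrt b)
    (h0 : |γ₁ 0 - γ₂ 0| ≤ L ^ 2) :
    |γ₁' 0 - γ₂' 0| ≤ Real.sqrt L := by
  have hsb : Real.sqrt b ≤ 1 / 2 := Real.sqrt_le_iff.2 ⟨by norm_num, by linarith⟩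
  have h := abs_deriv_mul_le_of_ne_zero (f := fun x ↦ γ₁ x - γ₂ x)
    (f' := fun x ↦ γ₁' x - γ₂' x) (f'' := fun x ↦ γ₁'' x - γ₂'' x) (M := 1) hL.le
    (fun x hx ↦ (hd1 x hx).sub (hd2 x hx)) (fun x hx ↦ (hd1' x hx).sub (hd2' x hx))
    (fun x hx ↦ (abs_sub _ _).trans (by linarith [hbd1 x hx, hbd2 x hx]))
    (fun x hx ↦ sub_ne_zero.2 (hdisj x hx))
  have h2L : |γ₁' 0 - γ₂' 0| ≤ 2 * L :=
    le_of_mul_le_mul_right (by linarith) hL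
  exact h2L.trans (Real.le_sqrt_of_sq_le (by nlinarith))
end

section
/- Let 0 < L < 1/4 and 0 < b ≤ 1/4. Let A : [−L, L] → ℝ be a twice continuously differentiable function such that A(x) > 0 for all x ∈ [−L, L], |A''(x)| ≤ 2√b for all x ∈ [−L, L], and A(0) ≤ L². Then |A'(0)| ≤ √L. -/
open Real Set

/-- One-sided second-order estimate: if `f'' ≤ C` on `[0, L]`, then
`f L ≤ f 0 + L * (f' 0 + C * L)`. -/
theorem le_add_mul_of_second_deriv_le {f f' f'' : ℝ → ℝ} {L C : ℝ} (hL : 0 < L) (hC : 0 ≤ C)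
    (hf : ∀ x ∈ Icc 0 L, HasDerivAt f (f' x) x)
    (hf' : ∀ x ∈ Icc 0 L, HasDerivAt f' (f'' x) x)
    (hbd : ∀ x ∈ Icc 0 L, f'' x ≤ C) :
    f L ≤ f 0 + L * (f' 0 + C * L) := by
  obtain ⟨c, hc, hfc⟩ := exists_hasDerivAt_eq_slope f f' hL
    (fun x hx => (hf x hx).continuousAt.continuousWithinAt)
    (fun x hx => hf x (Ioo_subset_Icc_self hx))
  have hsub : Icc 0 c ⊆ Icc 0 L := Icc_subset_Icc_right hc.2.le
  obtain ⟨d, hd, hfd⟩ := exists_hasDerivAt_eq_slope f' f'' hc.1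
    (fun x hx => (hf' x (hsub hx)).continuousAt.continuousWithinAt)
    (fun x hx => hf' x (hsub (Ioo_subset_Icc_self hx)))
  have hdC := hbd d (hsub (Ioo_subset_Icc_self hd))
  rw [sub_zero, eq_div_iff hL.ne'] at hfc
  rw [sub_zero, eq_div_iff hc.1.ne'] at hfd
  have hc' : f' c ≤ f' 0 + C * L := by
    have h₁ := mul_le_mul_of_nonneg_right hdC hc.1.le
    have h₂ := mul_le_mul_of_nonneg_left hc.2.le hC
    linarith
  have := mul_le_mul_of_nonneg_left hc' hL.le
  linarith

/-- A function with `f'' ≤ 1` on `[0, L]`, `f 0 ≤ L ^ 2` and `0 < f L` cannot start out with slope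
below `-√L` when `L ≤ 1 / 4`. -/
theorem neg_sqrt_le_deriv_of_pos {f f' f'' : ℝ → ℝ} {L : ℝ} (hL : 0 < L) (hL' : L ≤ 1 / 4)
    (hf : ∀ x ∈ Icc 0 L, HasDerivAt f (f' x) x)
    (hf' : ∀ x ∈ Icc 0 L, HasDerivAt f' (f'' x) x)
    (hbd : ∀ x ∈ Icc 0 L, f'' x ≤ 1) (h0 : f 0 ≤ L ^ 2) (hpos : 0 < f L) :
    -√L ≤ f' 0 := by
  have h := le_add_mul_of_second_deriv_le hL zero_le_one hf hf' hbd
  have hsqrt : 2 * L ≤ √L := Real.le_sqrt_of_sq_le (by nlinarith)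
  have hprod : 0 < L * (2 * L + f' 0) := by linarith
  linarith [pos_of_mul_pos_right hprod hL.le]

/-- Core estimate in the proof of Sublemma (angleint): a positive C² function `A`
on [-L, L] with `|A''| ≤ 2√b` and `A 0 ≤ L²` satisfies `|A' 0| ≤ √L`. -/
theorem angleint_core (L b : ℝ) (hL : 0 < L) (hL' : L < 1/4)
    (hb : 0 < b) (hb' : b ≤ 1/4)
    (A A' A'' : ℝ → ℝ)
    (hd : ∀ x ∈ Icc (-L) L, HasDerivAt A (A' x) x)
    (hd' : ∀ x ∈ Icc (-L) L, HasDerivAt A' (A'' x) x)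
    (hc : ContinuousOn A'' (Icc (-L) L))
    (hpos : ∀ x ∈ Icc (-L) L, 0 < A x)
    (hbd : ∀ x ∈ Icc (-L) L, |A'' x| ≤ 2 * Real.sqrt b)
    (h0 : A 0 ≤ L ^ 2) :
    |A' 0| ≤ Real.sqrt L := by
  have hsqrt : 2 * √b ≤ 1 := by
    have : √b ≤ 1 / 2 := Real.sqrt_le_iff.2 ⟨by norm_num, by linarith⟩
    linarith
  have hmem : ∀ x ∈ Icc 0 L, x ∈ Icc (-L) L := fun x hx => ⟨by linarith [hx.1], hx.2⟩
  have hneg : ∀ x ∈ Icc 0 L, -x ∈ Icc (-L) L := fun x hx =>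
    ⟨by linarith [hx.2], by linarith [hx.1]⟩
  have hle : ∀ x ∈ Icc (-L) L, A'' x ≤ 1 := fun x hx =>
    (le_abs_self _).trans ((hbd x hx).trans hsqrt)
  have hright : -√L ≤ A' 0 :=
    neg_sqrt_le_deriv_of_pos hL hL'.le (fun x hx => hd x (hmem x hx))
      (fun x hx => hd' x (hmem x hx)) (fun x hx => hle x (hmem x hx)) h0
      (hpos L ⟨by linarith, le_rfl⟩)
  have hleft : -√L ≤ -A' (-0) :=
    neg_sqrt_le_deriv_of_pos (f := fun x => A (-x)) (f' := fun x => -A' (-x))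
      (f'' := fun x => A'' (-x)) hL hL'.le
      (fun x hx => by
        simpa [Function.comp_def] using (hd (-x) (hneg x hx)).scomp x (hasDerivAt_neg x))
      (fun x hx => by
        simpa [Function.comp_def] using ((hd' (-x) (hneg x hx)).scomp x (hasDerivAt_neg x)).fun_neg)
      (fun x hx => hle (-x) (hneg x hx)) (by simpa using h0)
      (hpos (-L) ⟨le_rfl, by linarith⟩)
  rw [neg_zero] at hleft
  exact abs_le.2 ⟨hright, by linarith⟩
end
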